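/- Let R = S ×_k T be a non-trivial fiber product and let M, N be finitely generated R-modules such that Ext_R^i(M, N) = 0 for all sufficiently large i. Then Ext_R^i(M, N) = 0 for all i > depth(R); in particular, since depth(R) ≤ 1, Ext_R^i(M, N) = 0 for all i ≥ 2. -/

import Mathlib

open CategoryTheory Opposite IsLocalRing

noncomputable section

set_option maxHeartbeats 1000000
set_option synthInstance.maxHeartbeats 1000000

/-- Vanishing of `Tor_i^A(M, N)`. -/
abbrev TorZero (A : Type) [CommRing A] (M N : Type) [AddCommGroup M] [Module A M]
    [AddCommGroup N] [Module A N] (i : ℕ) : Prop :=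
  Subsingleton (((Tor (ModuleCat A) i).obj (ModuleCat.of A M)).obj (ModuleCat.of A N))

/-- Vanishing of `Ext^i_A(M, N)`. -/
abbrev ExtZero (A : Type) [CommRing A] (M N : Type) [AddCommGroup M] [Module A M]
    [AddCommGroup N] [Module A N] (i : ℕ) : Prop :=
  Subsingleton (((Ext A (ModuleCat A) i).obj (op (ModuleCat.of A M))).obj (ModuleCat.of A N))

/-- `M` has projective dimension at most `n` over `A`:
`Ext^i_A(M, -) = 0` for all `i > n`. -/
def PdLE (A : Type) [CommRing A] (M : Type) [AddCommGroup M] [Module A M] (n : ℕ) : Prop :=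
  ∀ (N : ModuleCat A) (i : ℕ), n < i →
    Subsingleton (((Ext A (ModuleCat A) i).obj (op (ModuleCat.of A M))).obj N)

/-- `N` has injective dimension at most `n` over `A`:
`Ext^i_A(-, N) = 0` for all `i > n`. -/
def IdLE (A : Type) [CommRing A] (N : Type) [AddCommGroup N] [Module A N] (n : ℕ) : Prop :=
  ∀ (X : ModuleCat A) (i : ℕ), n < i →
    Subsingleton (((Ext A (ModuleCat A) i).obj (op X)).obj (ModuleCat.of A N))

/-- The depth of a module over a noetherian local ring, as an extended natural number:
`inf { i | Ext^i_A(k, M) ≠ 0 }`. -/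
def depthM (A : Type) [CommRing A] [IsLocalRing A] (M : Type) [AddCommGroup M]
    [Module A M] : ℕ∞ :=
  sInf {n : ℕ∞ | ∃ i : ℕ, n = i ∧
    ¬ Subsingleton (((Ext A (ModuleCat A) i).obj
        (op (ModuleCat.of A (A ⧸ maximalIdeal A)))).obj (ModuleCat.of A M))}

/-- The fiber product `S ×ₖ T` as a subring of `S × T`. -/
def fiberProd {S T k : Type} [CommRing S] [CommRing T] [CommRing k]
    (πS : S →+* k) (πT : T →+* k) : Subring (S × T) :=
  RingHom.eqLocus (πS.comp (RingHom.fst S T)) (πT.comp (RingHom.snd S T))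

/-- The projection from the fiber product to `S`. -/
def ρS {S T k : Type} [CommRing S] [CommRing T] [CommRing k]
    (πS : S →+* k) (πT : T →+* k) : ↥(fiberProd πS πT) →+* S :=
  (RingHom.fst S T).comp (fiberProd πS πT).subtype

/-- The projection from the fiber product to `T`. -/
def ρT {S T k : Type} [CommRing S] [CommRing T] [CommRing k]
    (πS : S →+* k) (πT : T →+* k) : ↥(fiberProd πS πT) →+* T :=
  (RingHom.snd S T).comp (fiberProd πS πT).subtype

/-- The `i`-th Betti number of a module `M` over a noetherian local ring `A`:
the `k`-dimension of `Tor_i^A(M, k) ⊗_A k`; since `Tor_i^A(M, k)` is annihilated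
by the maximal ideal, this is `dim_k Tor_i^A(M, k)`. -/
noncomputable def betti (A : Type) [CommRing A] [IsLocalRing A] (M : Type) [AddCommGroup M]
    [Module A M] (i : ℕ) : ℕ :=
  let X : ModuleCat A :=
    ((Tor (ModuleCat A) i).obj (ModuleCat.of A M)).obj (ModuleCat.of A (A ⧸ maximalIdeal A))
  Module.finrank (A ⧸ maximalIdeal A) (X ⧸ (maximalIdeal A • (⊤ : Submodule A X)))

/-- `M` is a first syzygy over `A` of a finitely generated `A`-module, i.e. `M` embeds
into a finite free `A`-module (as the kernel of `F ↠ L` for the quotient `L`). -/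
def IsFirstSyzygy (A : Type) [CommRing A] (M : Type) [AddCommGroup M] [Module A M] : Prop :=
  ∃ (n : ℕ) (f : M →ₗ[A] (Fin n → A)), Function.Injective f

universe u

section Bridge

variable {R : Type u} [CommRing R]

theorem subsingleton_ext_iff_forall_exists {X : ModuleCat.{u} R} (P : ProjectiveResolution X)
    (Y : ModuleCat.{u} R) (n : ℕ) :
    Subsingleton (((Ext R (ModuleCat R) (n + 1)).obj (op X)).obj Y) ↔
      ∀ f : P.complex.X (n + 1) ⟶ Y, P.complex.d (n + 2) (n + 1) ≫ f = 0 →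
        ∃ g : P.complex.X n ⟶ Y, P.complex.d (n + 1) n ≫ g = f := by
  rw [← ModuleCat.isZero_iff_subsingleton, (P.isoExt (n + 1) Y).isZero_iff,
    ← HomologicalComplex.exactAt_iff_isZero_homology,
    HomologicalComplex.exactAt_iff' _ n (n + 1) (n + 2) (by simp) (by simp),
    ShortComplex.moduleCat_exact_iff]
  rfl

theorem subsingleton_ext_iff_subsingleton_abelianExt (X Y : ModuleCat.{u} R) (n : ℕ) :
    Subsingleton (((Ext R (ModuleCat R) (n + 1)).obj (op X)).obj Y) ↔
      Subsingleton (Abelian.Ext X Y (n + 1)) := by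
  let P := projectiveResolution X
  rw [subsingleton_ext_iff_forall_exists P]
  constructor
  · intro h
    refine subsingleton_of_forall_eq 0 fun α ↦ ?_
    obtain ⟨f, hf, rfl⟩ := P.extMk_surjective α (n + 2) rfl
    exact (P.extMk_eq_zero_iff f _ _ hf n rfl).2 (h f hf)
  · intro h f hf
    exact (P.extMk_eq_zero_iff f (n + 2) rfl hf n rfl).1 (Subsingleton.elim _ _)

theorem exists_hom_ne_zero_of_not_subsingleton_ext_zero (X Y : ModuleCat.{u} R)
    (h : ¬ Subsingleton (((Ext R (ModuleCat R) 0).obj (op X)).obj Y)) :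
    ∃ f : X ⟶ Y, f ≠ 0 := by
  let P := projectiveResolution X
  rw [← ModuleCat.isZero_iff_subsingleton, (P.isoExt 0 Y).isZero_iff,
    ← HomologicalComplex.exactAt_iff_isZero_homology,
    HomologicalComplex.exactAt_iff' _ 0 0 1 (by simp) (by simp),
    ShortComplex.moduleCat_exact_iff] at h
  push Not at h
  obtain ⟨f, hf, hne⟩ := h
  change P.complex.X 0 ⟶ Y at f
  change P.complex.d 1 0 ≫ f = 0 at hf
  refine ⟨P.exact₀.desc f hf, fun h0 ↦ hne 0 ?_⟩
  have hf0 : f = 0 := (P.exact₀.g_desc f hf).symm.trans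
    ((congrArg (P.π.f 0 ≫ ·) h0).trans Limits.comp_zero)
  exact (map_zero _).trans hf0.symm

end Bridge

section Vanishing

variable {R : Type u} [CommRing R]

/-- `Abelian.Ext X N i` vanishes for all `i ≥ c`. -/
def ExtVanishesFrom (N : ModuleCat.{u} R) (c : ℕ) (X : Type u) [AddCommGroup X] [Module R X] :
    Prop :=
  ∀ i ≥ c, Subsingleton (Abelian.Ext (ModuleCat.of R X) N i)

namespace ExtVanishesFrom

variable {N : ModuleCat.{u} R} {c : ℕ}
  {X A B C : Type u} [AddCommGroup X] [Module R X] [AddCommGroup A] [Module R A]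
  [AddCommGroup B] [Module R B] [AddCommGroup C] [Module R C]

theorem mono {d : ℕ} (h : ExtVanishesFrom N c X) (hd : c ≤ d) : ExtVanishesFrom N d X :=
  fun i hi ↦ h i (hd.trans hi)

theorem of_retract (h : ExtVanishesFrom N c B) (f : A →ₗ[R] B) (g : B →ₗ[R] A)
    (hgf : ∀ a, g (f a) = a) : ExtVanishesFrom N c A := by
  intro i hi
  have := h i hi
  refine subsingleton_of_forall_eq 0 fun x ↦ ?_
  have hfg : ModuleCat.ofHom f ≫ ModuleCat.ofHom g = 𝟙 (ModuleCat.of R A) := by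
    ext a
    exact hgf a
  rw [← Abelian.Ext.mk₀_id_comp x, ← hfg, ← Abelian.Ext.mk₀_comp_mk₀_assoc,
    Subsingleton.elim ((Abelian.Ext.mk₀ (ModuleCat.ofHom g)).comp x (zero_add i)) 0,
    Abelian.Ext.comp_zero]

theorem of_equiv (h : ExtVanishesFrom N c B) (e : A ≃ₗ[R] B) : ExtVanishesFrom N c A :=
  h.of_retract e.toLinearMap e.symm.toLinearMap e.symm_apply_apply

theorem of_projective [Module.Projective R X] : ExtVanishesFrom N 1 X := by
  intro i hi
  obtain ⟨j, rfl⟩ := Nat.exists_eq_add_of_le' hi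
  have : Projective (ModuleCat.of R X) := ModuleCat.projective_of_categoryTheory_projective _
  exact Abelian.Ext.subsingleton_of_projective _ _ _

section Exact

variable {f : A →ₗ[R] B} {g : B →ₗ[R] C}

/-- The short complex of an exact sequence of modules. -/
abbrev shortComplex (hfg : Function.Exact f g) : ShortComplex (ModuleCat.{u} R) :=
  ShortComplex.mk (ModuleCat.ofHom f) (ModuleCat.ofHom g) (by
    ext x
    exact hfg.apply_apply_eq_zero x)

theorem shortExact_shortComplex (hf : Function.Injective f)
    (hg : Function.Surjective g) (hfg : Function.Exact f g) :
    (shortComplex hfg).ShortExact where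
  exact := (ShortComplex.ShortExact.moduleCat_exact_iff_function_exact _).2 hfg
  mono_f := (ModuleCat.mono_iff_injective _).2 hf
  epi_g := (ModuleCat.epi_iff_surjective _).2 hg

theorem of_exact₁ (hf : Function.Injective f)
    (hg : Function.Surjective g) (hfg : Function.Exact f g)
    (hB : ExtVanishesFrom N c B) (hC : ExtVanishesFrom N (c + 1) C) :
    ExtVanishesFrom N c A := by
  intro i hi
  have := hB i hi
  have := hC (i + 1) (by lia)
  have hS := shortExact_shortComplex hf hg hfg
  refine subsingleton_of_forall_eq 0 fun x ↦ ?_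
  obtain ⟨y, rfl⟩ := Abelian.Ext.contravariant_sequence_exact₁ hS N x (add_comm 1 i)
    (Subsingleton.elim (α := Abelian.Ext (ModuleCat.of R C) N (i + 1)) _ _)
  rw [Subsingleton.elim (α := Abelian.Ext (ModuleCat.of R B) N i) y 0, Abelian.Ext.comp_zero]

theorem of_exact₂ (hf : Function.Injective f)
    (hg : Function.Surjective g) (hfg : Function.Exact f g)
    (hA : ExtVanishesFrom N c A) (hC : ExtVanishesFrom N c C) :
    ExtVanishesFrom N c B := by
  intro i hi
  have := hA i hi
  have := hC i hi
  have hS := shortExact_shortComplex hf hg hfg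
  refine subsingleton_of_forall_eq 0 fun x ↦ ?_
  obtain ⟨y, rfl⟩ := Abelian.Ext.contravariant_sequence_exact₂ hS N x
    (Subsingleton.elim (α := Abelian.Ext (ModuleCat.of R A) N i) _ _)
  rw [Subsingleton.elim (α := Abelian.Ext (ModuleCat.of R C) N i) y 0, Abelian.Ext.comp_zero]

theorem of_exact₃ (hf : Function.Injective f)
    (hg : Function.Surjective g) (hfg : Function.Exact f g)
    (hA : ExtVanishesFrom N c A) (hB : ExtVanishesFrom N (c + 1) B) :
    ExtVanishesFrom N (c + 1) C := by
  intro i hi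
  obtain ⟨i, rfl⟩ : ∃ j, i = j + 1 := ⟨i - 1, by lia⟩
  have := hA i (by lia)
  have := hB (i + 1) hi
  have hS := shortExact_shortComplex hf hg hfg
  refine subsingleton_of_forall_eq 0 fun x ↦ ?_
  obtain ⟨y, rfl⟩ := Abelian.Ext.contravariant_sequence_exact₃ hS N x
    (Subsingleton.elim (α := Abelian.Ext (ModuleCat.of R B) N (i + 1)) _ _) (add_comm 1 i)
  rw [Subsingleton.elim (α := Abelian.Ext (ModuleCat.of R A) N i) y 0, Abelian.Ext.comp_zero]

end Exact

theorem prod (hA : ExtVanishesFrom N c A) (hB : ExtVanishesFrom N c B) :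
    ExtVanishesFrom N c (A × B) :=
  of_exact₂ LinearMap.inl_injective LinearMap.snd_surjective Function.Exact.inl_snd hA hB

theorem ker [Module.Projective R B] (hc : 1 ≤ c) {g : B →ₗ[R] C} (hg : Function.Surjective g)
    (hC : ExtVanishesFrom N (c + 1) C) : ExtVanishesFrom N c (LinearMap.ker g) :=
  of_exact₁ (LinearMap.ker g).injective_subtype hg (LinearMap.exact_subtype_ker_map g)
    (of_projective.mono hc) hC

theorem of_ker [Module.Projective R B] {g : B →ₗ[R] C} (hg : Function.Surjective g)
    (hA : ExtVanishesFrom N c (LinearMap.ker g)) : ExtVanishesFrom N (c + 1) C :=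
  of_exact₃ (LinearMap.ker g).injective_subtype hg (LinearMap.exact_subtype_ker_map g)
    hA (of_projective.mono (by lia))

theorem ideal {I : Ideal R} (hc : 1 ≤ c) (h : ExtVanishesFrom N (c + 1) (R ⧸ I)) :
    ExtVanishesFrom N c I :=
  of_exact₁ I.injective_subtype I.mkQ_surjective (LinearMap.exact_subtype_mkQ I)
    (of_projective.mono hc) h

theorem quotient {I : Ideal R} (h : ExtVanishesFrom N c I) :
    ExtVanishesFrom N (c + 1) (R ⧸ I) :=
  of_exact₃ I.injective_subtype I.mkQ_surjective (LinearMap.exact_subtype_mkQ I)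
    h (of_projective.mono (by lia))

variable [IsNoetherianRing R] [IsLocalRing R] [Module.Finite R N]

theorem of_exact_smul [Module.Finite R X] {x : R} (hx : x ∈ maximalIdeal R)
    {g : X →ₗ[R] C} (hinj : Function.Injective (x • (LinearMap.id : X →ₗ[R] X)))
    (hg : Function.Surjective g) (hfg : Function.Exact (x • (LinearMap.id : X →ₗ[R] X)) g)
    (hC : ExtVanishesFrom N c C) : ExtVanishesFrom N c X := by
  intro i hi
  have := hC (i + 1) (by lia)
  have hS := shortExact_shortComplex hinj hg hfg
  have hsurj : ∀ y : Abelian.Ext (ModuleCat.of R X) N i, ∃ z, x • z = y := by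
    intro y
    obtain ⟨z, hz⟩ := Abelian.Ext.contravariant_sequence_exact₁ hS N y (add_comm 1 i)
      (Subsingleton.elim (α := Abelian.Ext (ModuleCat.of R C) N (i + 1)) _ _)
    refine ⟨z, hz ▸ ?_⟩
    have : (shortComplex hfg).f = x • 𝟙 (ModuleCat.of R X) := rfl
    rw [this, Abelian.Ext.mk₀_smul, Abelian.Ext.smul_comp, Abelian.Ext.mk₀_id_comp]
  have : (⊤ : Submodule R (Abelian.Ext (ModuleCat.of R X) N i)) = ⊥ := by
    refine Submodule.eq_bot_of_le_smul_of_le_jacobson_bot (maximalIdeal R) _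
      Module.Finite.fg_top (fun y _ ↦ ?_) (maximalIdeal_le_jacobson _)
    obtain ⟨z, rfl⟩ := hsurj y
    exact Submodule.smul_mem_smul hx trivial
  exact (Submodule.subsingleton_iff R).1 (subsingleton_of_bot_eq_top this.symm)

theorem quotient_of_residue (h : ExtVanishesFrom N c (R ⧸ maximalIdeal R)) (I : Ideal R) :
    ExtVanishesFrom N c (R ⧸ I) := by
  induction I using IsNoetherian.induction with
  | hgt I ih =>
    by_cases htop : I = ⊤
    · subst htop
      exact h.of_retract 0 0 fun _ ↦ Subsingleton.elim _ _
    by_cases hmax : I = maximalIdeal R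
    · rwa [hmax]
    obtain ⟨x, hxm, hxI⟩ := SetLike.exists_of_lt ((le_maximalIdeal htop).lt_of_ne hmax)
    let φ : R →ₗ[R] R ⧸ I := x • I.mkQ
    have hle : I ≤ I ⊔ Ideal.span {x} := le_sup_left
    have hker : I ≤ LinearMap.ker φ := fun r hr ↦ by
      rw [LinearMap.mem_ker, LinearMap.smul_apply, Submodule.mkQ_apply,
        (Submodule.Quotient.mk_eq_zero I).2 hr, smul_zero]
    have hC : ExtVanishesFrom N c (R ⧸ (I ⊔ Ideal.span {x})) :=
      ih _ (left_lt_sup.2 fun h ↦ hxI (h (Ideal.mem_span_singleton_self x)))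
    have hg : Function.Surjective (Submodule.factor hle) := Submodule.factor_surjective hle
    have hexact : Function.Exact φ (Submodule.factor hle) := by
      intro y
      obtain ⟨y, rfl⟩ := I.mkQ_surjective y
      rw [Submodule.factor_mk, Submodule.mkQ_apply, Submodule.mkQ_apply,
        Submodule.Quotient.mk_eq_zero, Submodule.mem_sup]
      constructor
      · rintro ⟨a, ha, b, hb, rfl⟩
        obtain ⟨r, rfl⟩ := Ideal.mem_span_singleton'.1 hb
        refine ⟨r, ?_⟩
        rw [eq_comm, ← sub_eq_zero]
        change Submodule.Quotient.mk (a + r * x - x * r) = _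
        rw [Submodule.Quotient.mk_eq_zero, mul_comm, add_sub_cancel_right]
        exact ha
      · rintro ⟨r, hr⟩
        refine ⟨y - x * r, ?_, x * r, Ideal.mul_mem_right _ _ (Ideal.mem_span_singleton_self x),
          sub_add_cancel _ _⟩
        rw [← Submodule.Quotient.mk_eq_zero I, Submodule.Quotient.mk_sub, ← hr]
        exact sub_self _
    by_cases hk : LinearMap.ker φ = I
    · have hcomp : ∀ r, (x • LinearMap.id : (R ⧸ I) →ₗ[R] (R ⧸ I)) (I.mkQ r) = φ r :=
        fun r ↦ rfl
      refine of_exact_smul (g := Submodule.factor hle) hxm ?_ hg ?_ hC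
      · rw [injective_iff_map_eq_zero]
        intro y hy
        obtain ⟨y, rfl⟩ := I.mkQ_surjective y
        rw [hcomp, ← LinearMap.mem_ker, hk] at hy
        exact (Submodule.Quotient.mk_eq_zero I).2 hy
      · intro y
        rw [hexact y]
        constructor
        · rintro ⟨r, rfl⟩
          exact ⟨_, hcomp r⟩
        · rintro ⟨z, rfl⟩
          obtain ⟨z, rfl⟩ := I.mkQ_surjective z
          exact ⟨z, (hcomp z).symm⟩
    · have hA := ih _ (hker.lt_of_ne (Ne.symm hk))
      refine of_exact₂ (f := (LinearMap.ker φ).liftQ φ le_rfl)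
        (LinearMap.ker_eq_bot.1 (Submodule.ker_liftQ_eq_bot _ _ _ le_rfl)) hg ?_ hA hC
      intro y
      rw [hexact y]
      constructor
      · rintro ⟨r, rfl⟩
        exact ⟨Submodule.Quotient.mk r, rfl⟩
      · rintro ⟨z, rfl⟩
        obtain ⟨z, rfl⟩ := Submodule.mkQ_surjective _ z
        exact ⟨z, rfl⟩

theorem of_residue (h : ExtVanishesFrom N c (R ⧸ maximalIdeal R)) (M : Type u)
    [AddCommGroup M] [Module R M] [hM : Module.Finite R M] : ExtVanishesFrom N c M := by
  induction hM using IsNoetherianRing.induction_on_isQuotientEquivQuotientPrime R with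
  | subsingleton M => exact h.of_retract 0 0 fun _ ↦ Subsingleton.elim _ _
  | quotient M p e => exact (h.quotient_of_residue p.1).of_equiv e
  | exact A B C f g hf hg hfg hA hC => exact of_exact₂ hf hg hfg hA hC

end ExtVanishesFrom

end Vanishing

section MinimalCover

theorem exists_minimal_cover (R : Type u) [CommRing R] [IsLocalRing R] (X : Type u)
    [AddCommGroup X] [Module R X] [Module.Finite R X] :
    ∃ (n : ℕ) (f : (Fin n → R) →ₗ[R] X), Function.Surjective f ∧
      ∀ v, f v = 0 → ∀ j, v j ∈ maximalIdeal R := by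
  classical
  have hex : ∃ (n : ℕ) (f : (Fin n → R) →ₗ[R] X), Function.Surjective f :=
    Module.Finite.exists_fin' R X
  obtain ⟨f, hf⟩ := Nat.find_spec hex
  refine ⟨Nat.find hex, f, hf, fun v hv j ↦ ?_⟩
  by_contra hj
  have hmin : ∀ m < Nat.find hex, ¬ ∃ f : (Fin m → R) →ₗ[R] X, Function.Surjective f :=
    fun m ↦ Nat.find_min hex
  generalize Nat.find hex = n at f v j hmin
  obtain _ | n := n
  · exact j.elim0
  obtain ⟨t, ht⟩ := isUnit_iff_exists_inv.1 ((notMem_maximalIdeal).1 hj)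
  let s : (Fin n → R) →ₗ[R] (Fin (n + 1) → R) :=
    { toFun u := j.insertNth (α := fun _ ↦ R) 0 u
      map_add' u w := by
        refine funext fun i ↦ ?_
        obtain rfl | ⟨i, rfl⟩ := j.eq_self_or_eq_succAbove i <;> simp
      map_smul' a u := by
        refine funext fun i ↦ ?_
        obtain rfl | ⟨i, rfl⟩ := j.eq_self_or_eq_succAbove i <;> simp }
  refine hmin n n.lt_succ_self ⟨f ∘ₗ s, fun x ↦ ?_⟩
  obtain ⟨w, rfl⟩ := hf x
  refine ⟨fun i ↦ (w - (w j * t) • v) (j.succAbove i), ?_⟩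
  have hs : s (fun i ↦ (w - (w j * t) • v) (j.succAbove i)) = w - (w j * t) • v := by
    refine funext fun i ↦ ?_
    obtain rfl | ⟨i, rfl⟩ := j.eq_self_or_eq_succAbove i
    · simp [s, mul_assoc, mul_comm t, ht]
    · simp [s]
  rw [LinearMap.comp_apply, hs, map_sub, map_smul, hv, smul_zero, sub_zero]

end MinimalCover

section Decomposition

variable {R : Type u} [CommRing R] [IsLocalRing R]

/-- The maximal ideal of `R` is the internal direct sum of the nonzero ideals `I` and `J`. -/
structure IsMaximalIdealDecomposition (I J : Ideal R) : Prop where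
  inf_eq_bot : I ⊓ J = ⊥
  sup_eq : I ⊔ J = maximalIdeal R
  left_ne_bot : I ≠ ⊥
  right_ne_bot : J ≠ ⊥

namespace IsMaximalIdealDecomposition

variable {I J : Ideal R}

theorem symm (h : IsMaximalIdealDecomposition I J) : IsMaximalIdealDecomposition J I where
  inf_eq_bot := inf_comm I J ▸ h.inf_eq_bot
  sup_eq := sup_comm I J ▸ h.sup_eq
  left_ne_bot := h.right_ne_bot
  right_ne_bot := h.left_ne_bot

theorem mul_eq_zero (h : IsMaximalIdealDecomposition I J)
    {a b : R} (ha : a ∈ I) (hb : b ∈ J) : a * b = 0 := by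
  rw [← Ideal.mem_bot, ← h.inf_eq_bot]
  exact ⟨I.mul_mem_right _ ha, J.mul_mem_left _ hb⟩

theorem exists_equiv (h : IsMaximalIdealDecomposition I J) : ∃ e : (I × J) ≃ₗ[R] maximalIdeal R,
    ∀ p, (e p : R) = p.1 + p.2 := by
  let f : (I × J) →ₗ[R] maximalIdeal R :=
    LinearMap.codRestrict (maximalIdeal R) (I.subtype.coprod J.subtype) fun p ↦
      h.sup_eq ▸ Submodule.add_mem_sup p.1.2 p.2.2
  have hf : ∀ p, (f p : R) = p.1 + p.2 := fun p ↦ rfl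
  refine ⟨LinearEquiv.ofBijective f ⟨?_, ?_⟩, hf⟩
  · rw [injective_iff_map_eq_zero]
    intro p hp
    have h0 : (p.1 : R) + p.2 = 0 := by rw [← hf, hp]; rfl
    have h1 : (p.1 : R) ∈ I ⊓ J := ⟨p.1.2, by
      rw [eq_neg_of_add_eq_zero_left h0]
      exact J.neg_mem p.2.2⟩
    rw [h.inf_eq_bot, Ideal.mem_bot] at h1
    rw [h1, zero_add] at h0
    exact Prod.ext (Subtype.ext h1) (Subtype.ext h0)
  · rintro ⟨x, hx⟩
    rw [← h.sup_eq] at hx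
    obtain ⟨a, ha, b, hb, rfl⟩ := Submodule.mem_sup.1 hx
    exact ⟨(⟨a, ha⟩, ⟨b, hb⟩), rfl⟩

theorem exists_projection (h : IsMaximalIdealDecomposition I J) : ∃ p : maximalIdeal R →ₗ[R] I,
    (∀ x : maximalIdeal R, (x : R) - p x ∈ J) ∧
      ∀ x : maximalIdeal R, (x : R) ∈ I → (p x : R) = x := by
  obtain ⟨e, he⟩ := h.exists_equiv
  refine ⟨LinearMap.fst R I J ∘ₗ e.symm.toLinearMap, fun x ↦ ?_, fun x hx ↦ ?_⟩
  · obtain ⟨p, rfl⟩ := e.surjective x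
    simp [he]
  · have : e (⟨x, hx⟩, 0) = x := Subtype.ext (by simp [he])
    rw [← this]
    simp [he]

variable {N : ModuleCat.{u} R} {c : ℕ}

theorem extVanishesFrom_maximalIdeal (h : IsMaximalIdealDecomposition I J)
    (hI : ExtVanishesFrom N c I) (hJ : ExtVanishesFrom N c J) :
    ExtVanishesFrom N c (maximalIdeal R) := by
  obtain ⟨e, -⟩ := h.exists_equiv
  exact (hI.prod hJ).of_equiv e.symm

theorem extVanishesFrom_left (h : IsMaximalIdealDecomposition I J)
    (hm : ExtVanishesFrom N c (maximalIdeal R)) :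
    ExtVanishesFrom N c I := by
  obtain ⟨e, -⟩ := h.exists_equiv
  refine hm.of_retract (e.toLinearMap ∘ₗ LinearMap.inl R I J)
    (LinearMap.fst R I J ∘ₗ e.symm.toLinearMap) fun a ↦ by simp

theorem extVanishesFrom_left_of_smul_eq_zero (h : IsMaximalIdealDecomposition I J)
    {X : Type u} [AddCommGroup X] [Module R X]
    [Module.Finite R X] [Nontrivial X] (hX : ∀ a ∈ I, ∀ x : X, a • x = 0)
    (hc : 1 ≤ c) (hv : ExtVanishesFrom N (c + 1) X) : ExtVanishesFrom N c I := by
  classical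
  obtain ⟨n, f, hf, hmin⟩ := exists_minimal_cover R X
  obtain ⟨p, -, hp⟩ := h.exists_projection
  obtain _ | n := n
  · exact (not_subsingleton X hf.subsingleton).elim
  let i : I →ₗ[R] LinearMap.ker f :=
    LinearMap.codRestrict _ (LinearMap.single R (fun _ : Fin (n + 1) ↦ R) 0 ∘ₗ I.subtype) fun a ↦ by
      have : LinearMap.single R (fun _ : Fin (n + 1) ↦ R) 0 (a : R) =
          (a : R) • Pi.single (0 : Fin (n + 1)) (1 : R) := by
        rw [← Pi.single_smul]
        simp
      rw [LinearMap.mem_ker, LinearMap.comp_apply, Submodule.subtype_apply, this, map_smul]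
      exact hX a a.2 _
  let r : LinearMap.ker f →ₗ[R] maximalIdeal R :=
    LinearMap.codRestrict _ (LinearMap.proj 0 ∘ₗ (LinearMap.ker f).subtype) fun v ↦ hmin v v.2 0
  have hri : ∀ a, (r (i a) : R) = a := fun a ↦ by
    change (Pi.single 0 (a : R) : Fin (n + 1) → R) 0 = a
    exact Pi.single_eq_same ..
  refine (hv.ker hc hf).of_retract i (p ∘ₗ r) fun a ↦ Subtype.ext ?_
  rw [LinearMap.comp_apply, hp _ (by rw [hri]; exact a.2), hri]

theorem smul_right_eq_zero (h : IsMaximalIdealDecomposition I J)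
    {a : R} (ha : a ∈ I) (x : J) : a • x = 0 :=
  Subtype.ext (h.mul_eq_zero ha x.2)

theorem extVanishesFrom_residue_of_smul_eq_zero (h : IsMaximalIdealDecomposition I J)
    [IsNoetherianRing R] {X : Type u}
    [AddCommGroup X] [Module R X]
    [Module.Finite R X] [Nontrivial X] (hX : ∀ a ∈ I, ∀ x : X, a • x = 0)
    (hc : 1 ≤ c) (hv : ExtVanishesFrom N (c + 2) X) :
    ExtVanishesFrom N (c + 2) (R ⧸ maximalIdeal R) := by
  have : Nontrivial I := Submodule.nontrivial_iff_ne_bot.2 h.left_ne_bot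
  have hI : ExtVanishesFrom N (c + 1) I :=
    h.extVanishesFrom_left_of_smul_eq_zero hX (by lia) hv
  have hJ : ExtVanishesFrom N c J :=
    h.symm.extVanishesFrom_left_of_smul_eq_zero (fun a ha ↦ h.symm.smul_right_eq_zero ha) hc hI
  exact (h.extVanishesFrom_maximalIdeal hI (hJ.mono (by lia))).quotient

theorem extVanishesFrom_residue_pred (h : IsMaximalIdealDecomposition I J)
    [IsNoetherianRing R] (hc : 1 ≤ c)
    (hv : ExtVanishesFrom N (c + 2) (R ⧸ maximalIdeal R)) :
    ExtVanishesFrom N (c + 1) (R ⧸ maximalIdeal R) := by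
  have : Nontrivial I := Submodule.nontrivial_iff_ne_bot.2 h.left_ne_bot
  have : Nontrivial J := Submodule.nontrivial_iff_ne_bot.2 h.right_ne_bot
  have hm := hv.ideal (by lia : 1 ≤ c + 1)
  have hI := h.extVanishesFrom_left hm
  have hJ := h.symm.extVanishesFrom_left hm
  exact (h.extVanishesFrom_maximalIdeal
    (h.extVanishesFrom_left_of_smul_eq_zero (fun a ha ↦ h.smul_right_eq_zero ha) hc hJ)
    (h.symm.extVanishesFrom_left_of_smul_eq_zero
      (fun a ha ↦ h.symm.smul_right_eq_zero ha) hc hI)).quotient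

theorem extVanishesFrom_two_residue (h : IsMaximalIdealDecomposition I J)
    [IsNoetherianRing R]
    (hv : ExtVanishesFrom N (c + 2) (R ⧸ maximalIdeal R)) :
    ExtVanishesFrom N 2 (R ⧸ maximalIdeal R) := by
  induction c with
  | zero => exact hv
  | succ c ih => exact ih (h.extVanishesFrom_residue_pred (by lia) hv)

/-- A submodule of `mRⁿ` stable under the projection `m → J` has its nonzero intersection with
`Jⁿ` as a retract, and that intersection is killed by `I`. -/
theorem extVanishesFrom_residue_of_submodule (h : IsMaximalIdealDecomposition I J)
    [IsNoetherianRing R] {n : ℕ}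
    {L : Submodule R (Fin n → R)} (hL : ∀ v ∈ L, ∀ j, v j ∈ maximalIdeal R)
    (hsplit : ∀ u w : Fin n → R, (∀ j, u j ∈ J) → (∀ j, w j ∈ I) → u + w ∈ L → u ∈ L)
    {v : Fin n → R} (hv : v ∈ L) (hvJ : ∀ j, v j ∈ J) (hv0 : v ≠ 0)
    (hc : 1 ≤ c) (hN : ExtVanishesFrom N (c + 2) L) :
    ExtVanishesFrom N (c + 2) (R ⧸ maximalIdeal R) := by
  obtain ⟨p, hp, hpJ⟩ := h.symm.exists_projection
  let LJ : Submodule R (Fin n → R) := L ⊓ Submodule.pi Set.univ fun _ ↦ J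
  let q : L →ₗ[R] (Fin n → R) := LinearMap.pi fun j ↦ J.subtype ∘ₗ p ∘ₗ
    LinearMap.codRestrict (maximalIdeal R) (LinearMap.proj j ∘ₗ L.subtype) fun v ↦ hL v v.2 j
  have hq : ∀ (x : L) j, q x j = p ⟨x.1 j, hL x x.2 j⟩ := fun x j ↦ rfl
  have hqL : ∀ x : L, q x ∈ LJ := fun x ↦
    ⟨hsplit (q x) (x - q x) (fun j ↦ (p _).2) (fun j ↦ hp ⟨x.1 j, hL x x.2 j⟩)
      (by rw [add_sub_cancel]; exact x.2), fun j _ ↦ (p _).2⟩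
  have hLJ : ExtVanishesFrom N (c + 2) LJ :=
    hN.of_retract (Submodule.inclusion inf_le_left) (q.codRestrict LJ hqL) fun x ↦ by
      refine Subtype.ext (funext fun j ↦ ?_)
      exact hpJ ⟨x.1 j, hL x x.2.1 j⟩ (x.2.2 j trivial)
  have : Nontrivial LJ :=
    ⟨⟨v, hv, fun j _ ↦ hvJ j⟩, 0, fun h0 ↦ hv0 (congrArg Subtype.val h0)⟩
  exact h.extVanishesFrom_residue_of_smul_eq_zero (fun a ha x ↦ Subtype.ext (funext fun j ↦
    h.mul_eq_zero ha (x.2.2 j trivial))) hc hLJ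

theorem extVanishesFrom_one_residue [IsNoetherianRing R] [Module.Finite R N]
    (hv : ExtVanishesFrom N 2 (R ⧸ maximalIdeal R)) {x : R} (hx : x ≠ 0)
    (hmx : ∀ a ∈ maximalIdeal R, a * x = 0) : ExtVanishesFrom N 1 (R ⧸ maximalIdeal R) := by
  let f : (R ⧸ maximalIdeal R) →ₗ[R] R :=
    (maximalIdeal R).liftQ (LinearMap.toSpanSingleton R R x) hmx
  have hf : Function.Injective f := by
    refine LinearMap.ker_eq_bot.1 (Submodule.ker_liftQ_eq_bot _ _ _ fun a ha ↦ ?_)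
    by_contra hu
    rw [notMem_maximalIdeal] at hu
    exact hx ((hu.mul_right_eq_zero).1 ha)
  exact ExtVanishesFrom.of_exact₁ hf (LinearMap.range f).mkQ_surjective
    (LinearMap.exact_map_mkQ_range f) ExtVanishesFrom.of_projective (hv.of_residue _)

theorem extVanishesFrom_two (h : IsMaximalIdealDecomposition I J)
    [IsNoetherianRing R] [Module.Finite R N] {M : Type u}
    [AddCommGroup M] [Module R M] [Module.Finite R M] (hM : ExtVanishesFrom N c M) :
    ExtVanishesFrom N 2 M ∧
      ∀ x : R, x ≠ 0 → (∀ a ∈ maximalIdeal R, a * x = 0) → ExtVanishesFrom N 1 M := by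
  obtain ⟨a, f, hf, hfmin⟩ := exists_minimal_cover R M
  obtain ⟨b, g, hg, hgmin⟩ := exists_minimal_cover R (LinearMap.ker f)
  by_cases hL : ∃ v, g v = 0 ∧ v ≠ 0
  · suffices hk : ExtVanishesFrom N (c + 1 + 2) (R ⧸ maximalIdeal R) by
      have hk2 := h.extVanishesFrom_two_residue hk
      exact ⟨hk2.of_residue M,
        fun x hx hmx ↦ (extVanishesFrom_one_residue hk2 hx hmx).of_residue M⟩
    obtain ⟨v, hv, hv0⟩ := hL
    have hN : ExtVanishesFrom N (c + 1 + 2) (LinearMap.ker g) :=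
      ((hM.mono (by lia : c ≤ c + 1 + 2 + 1 + 1)).ker (by lia) hf).ker (by lia) hg
    have hsplit {I₁ J₁ : Ideal R} (h₁ : I₁ ⊓ J₁ = ⊥) (u w : Fin b → R) (hu : ∀ j, u j ∈ J₁)
        (hw : ∀ j, w j ∈ I₁) (huw : u + w ∈ LinearMap.ker g) : u ∈ LinearMap.ker g := by
      refine Subtype.ext (funext fun i ↦ ?_)
      let φ : (Fin b → R) →ₗ[R] (Fin a → R) := (LinearMap.ker f).subtype ∘ₗ g
      have h0 : φ u i + φ w i = 0 := by
        rw [← Pi.add_apply, ← map_add]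
        exact congrFun (congrArg Subtype.val (LinearMap.mem_ker.1 huw)) i
      have hI : φ u i ∈ I₁ := by
        rw [eq_neg_of_add_eq_zero_left h0]
        exact I₁.neg_mem (Ideal.map_pi I₁ w hw φ i)
      have hIJ : φ u i ∈ I₁ ⊓ J₁ := ⟨hI, Ideal.map_pi J₁ u hu φ i⟩
      rwa [h₁, Ideal.mem_bot] at hIJ
    obtain ⟨p, hpJ, -⟩ := h.exists_projection
    let u : Fin b → R := fun j ↦ p ⟨v j, hgmin v hv j⟩
    let w : Fin b → R := v - u
    have hu : ∀ j, u j ∈ I := fun j ↦ (p _).2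
    have hw : ∀ j, w j ∈ J := fun j ↦ hpJ ⟨v j, hgmin v hv j⟩
    have huw : u + w = v := add_sub_cancel _ _
    have huL : u ∈ LinearMap.ker g :=
      hsplit h.symm.inf_eq_bot u w hu hw (huw ▸ hv)
    have hwL : w ∈ LinearMap.ker g :=
      hsplit h.inf_eq_bot w u hw hu (by rw [add_comm, huw]; exact hv)
    by_cases hw0 : w = 0
    · have hu0 : u ≠ 0 := fun hu0 ↦ hv0 (by rw [← huw, hu0, hw0, add_zero])
      exact h.symm.extVanishesFrom_residue_of_submodule hgmin (hsplit h.symm.inf_eq_bot)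
        huL hu hu0 (by lia) hN
    · exact h.extVanishesFrom_residue_of_submodule hgmin (hsplit h.inf_eq_bot)
        hwL hw hw0 (by lia) hN
  · push Not at hL
    have hginj : Function.Injective g := (injective_iff_map_eq_zero g).2 hL
    let e := LinearEquiv.ofBijective g ⟨hginj, hg⟩
    have hK : ExtVanishesFrom N 1 (LinearMap.ker f) := ExtVanishesFrom.of_projective.of_equiv e.symm
    refine ⟨hK.of_ker hf, fun x hx hmx ↦ ?_⟩
    have hxK : ∀ v, f v = 0 → x • v = 0 := fun v hv ↦ funext fun j ↦ by
      rw [Pi.smul_apply, smul_eq_mul, mul_comm, hmx _ (hfmin v hv j), Pi.zero_apply]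
    have hb : ∀ u : Fin b → R, u = 0 := fun u ↦ funext fun j ↦ by
      have h1 : x • Pi.single j (1 : R) = (0 : Fin b → R) := hL _ <| by
        rw [map_smul]
        exact Subtype.ext (hxK _ (g _).2)
      exact (hx (by simpa using congrFun h1 j)).elim
    have hfinj : Function.Injective f := by
      rw [injective_iff_map_eq_zero]
      intro v hv
      obtain ⟨u, hu⟩ := hg ⟨v, hv⟩
      rw [hb u, map_zero] at hu
      exact (congrArg Subtype.val hu).symm
    exact ExtVanishesFrom.of_projective.of_equiv (LinearEquiv.ofBijective f ⟨hfinj, hf⟩).symm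

theorem not_subsingleton_ext_one (h : IsMaximalIdealDecomposition I J) :
    ¬ Subsingleton (Abelian.Ext (ModuleCat.of R (R ⧸ maximalIdeal R)) (ModuleCat.of R R) 1) := by
  intro hsub
  obtain ⟨p, hpJ, hpI⟩ := h.exists_projection
  have hS := ExtVanishesFrom.shortExact_shortComplex (maximalIdeal R).injective_subtype
    (maximalIdeal R).mkQ_surjective (LinearMap.exact_subtype_mkQ (maximalIdeal R))
  obtain ⟨y, hy⟩ := Abelian.Ext.contravariant_sequence_exact₁ hS (ModuleCat.of R R)
    (Abelian.Ext.mk₀ (ModuleCat.ofHom (I.subtype ∘ₗ p))) (add_comm 1 0)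
    (Subsingleton.elim (α := Abelian.Ext (ModuleCat.of R (R ⧸ maximalIdeal R)) _ 1) _ _)
  obtain ⟨q, rfl⟩ := Abelian.Ext.addEquiv₀.symm.surjective y
  rw [Abelian.Ext.addEquiv₀_symm_apply, Abelian.Ext.mk₀_comp_mk₀] at hy
  have hq := Abelian.Ext.mk₀_bijective _ _ |>.1 hy
  have hval : ∀ x : maximalIdeal R, (x : R) * q.hom (1 : R) = p x := fun x ↦ by
    have := congrArg (fun φ ↦ φ.hom x) hq
    rw [← smul_eq_mul, ← map_smul, smul_eq_mul, mul_one]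
    exact this
  have hI : ∀ x ∈ I, x * (1 - q.hom (1 : R)) = 0 := fun x hx ↦ by
    have hxm : x ∈ maximalIdeal R := h.sup_eq ▸ Submodule.mem_sup_left hx
    rw [mul_sub, mul_one, hval ⟨x, hxm⟩, hpI ⟨x, hxm⟩ hx, sub_self]
  have hJ : ∀ x ∈ J, x * q.hom (1 : R) = 0 := fun x hx ↦ by
    have hxm : x ∈ maximalIdeal R := h.sup_eq ▸ Submodule.mem_sup_right hx
    rw [hval ⟨x, hxm⟩, ← Ideal.mem_bot, ← h.inf_eq_bot]
    refine ⟨(p _).2, ?_⟩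
    have := J.sub_mem hx (hpJ ⟨x, hxm⟩)
    rwa [sub_sub_cancel] at this
  rcases isUnit_or_isUnit_one_sub_self (q.hom (1 : R)) with hu | hu
  · exact h.right_ne_bot ((Submodule.eq_bot_iff _).2 fun x hx ↦ hu.mul_left_eq_zero.1 (hJ x hx))
  · exact h.left_ne_bot ((Submodule.eq_bot_iff _).2 fun x hx ↦ hu.mul_left_eq_zero.1 (hI x hx))

end IsMaximalIdealDecomposition

end Decomposition

section FiberProduct

variable {S T k : Type} [CommRing S] [CommRing T] [Field k] {πS : S →+* k} {πT : T →+* k}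

theorem ρS_surjective (hπT : Function.Surjective πT) : Function.Surjective (ρS πS πT) := by
  intro s
  obtain ⟨t, ht⟩ := hπT (πS s)
  exact ⟨⟨(s, t), ht.symm⟩, rfl⟩

theorem ρT_surjective (hπS : Function.Surjective πS) : Function.Surjective (ρT πS πT) := by
  intro t
  obtain ⟨s, hs⟩ := hπS (πT t)
  exact ⟨⟨(s, t), hs⟩, rfl⟩

theorem isNoetherian_compHom_of_surjective {A B : Type*} [CommRing A] [CommRing B]
    [IsNoetherianRing B] {φ : A →+* B} (hφ : Function.Surjective φ) :
    @IsNoetherian A B _ _ (Module.compHom B φ) := by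
  let := Module.compHom B φ
  have : RingHomSurjective φ := ⟨hφ⟩
  let l : B →ₛₗ[φ] B :=
    { toFun := id
      map_add' _ _ := rfl
      map_smul' _ _ := rfl }
  exact (LinearMap.isNoetherian_iff_of_bijective l Function.bijective_id).2 inferInstance

theorem isNoetherianRing_fiberProd [IsNoetherianRing S] [IsNoetherianRing T]
    (hπS : Function.Surjective πS) (hπT : Function.Surjective πT) :
    IsNoetherianRing (fiberProd πS πT) := by
  let := Module.compHom S (ρS πS πT)
  let := Module.compHom T (ρT πS πT)
  have := isNoetherian_compHom_of_surjective (ρS_surjective (πS := πS) hπT)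
  have := isNoetherian_compHom_of_surjective (ρT_surjective (πT := πT) hπS)
  let l : fiberProd πS πT →ₗ[fiberProd πS πT] S × T :=
    { toFun := Subtype.val
      map_add' _ _ := rfl
      map_smul' _ _ := rfl }
  exact isNoetherian_of_injective l Subtype.val_injective

theorem isMaximalIdealDecomposition_fiberProd [IsLocalRing S] [IsLocalRing T]
    [IsLocalRing (fiberProd πS πT)] (hπS : Function.Surjective πS) (hπT : Function.Surjective πT)
    (hkS : RingHom.ker πS = maximalIdeal S) (hkT : RingHom.ker πT = maximalIdeal T)
    (hS : maximalIdeal S ≠ ⊥) (hT : maximalIdeal T ≠ ⊥) :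
    IsMaximalIdealDecomposition (RingHom.ker (ρT πS πT)) (RingHom.ker (ρS πS πT)) where
  inf_eq_bot := (Submodule.eq_bot_iff _).2 fun x hx ↦ Subtype.ext (Prod.ext hx.2 hx.1)
  sup_eq := by
    have hmax : RingHom.ker (πS.comp (ρS πS πT)) = maximalIdeal _ := eq_maximalIdeal
      (RingHom.ker_isMaximal_of_surjective _ (hπS.comp (ρS_surjective hπT)))
    rw [← hmax]
    apply le_antisymm
    · refine sup_le (fun x hx ↦ ?_) fun x hx ↦ ?_
      · exact x.2.trans ((congrArg πT hx).trans (map_zero _))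
      · exact (congrArg πS hx).trans (map_zero _)
    · rintro ⟨⟨s, t⟩, hst⟩ hx
      have hs : πS s = 0 := hx
      have ht : πT t = 0 := hst.symm.trans hs
      refine Submodule.mem_sup.2 ⟨⟨(s, 0), hs.trans (map_zero πT).symm⟩, rfl,
        ⟨(0, t), (map_zero πS).trans ht.symm⟩, rfl, Subtype.ext ?_⟩
      exact Prod.ext (add_zero s) (zero_add t)
  left_ne_bot := by
    obtain ⟨s, hs, hs0⟩ := Submodule.exists_mem_ne_zero_of_ne_bot hS
    rw [← hkS, RingHom.mem_ker] at hs
    refine (Submodule.ne_bot_iff _).2 ⟨⟨(s, 0), hs.trans (map_zero πT).symm⟩, rfl, fun h ↦ hs0 ?_⟩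
    exact congrArg (ρS πS πT) h
  right_ne_bot := by
    obtain ⟨t, ht, ht0⟩ := Submodule.exists_mem_ne_zero_of_ne_bot hT
    rw [← hkT, RingHom.mem_ker] at ht
    refine (Submodule.ne_bot_iff _).2 ⟨⟨(0, t), (map_zero πS).trans ht.symm⟩, rfl, fun h ↦ ht0 ?_⟩
    exact congrArg (ρT πS πT) h

end FiberProduct

section Depth

variable {A : Type} [CommRing A] [IsLocalRing A]

theorem exists_socle_of_depthM_lt_one (h : depthM A A < 1) :
    ∃ x : A, x ≠ 0 ∧ ∀ a ∈ maximalIdeal A, a * x = 0 := by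
  obtain ⟨_, ⟨i, rfl, hi⟩, hi1⟩ := sInf_lt_iff.1 h
  obtain rfl : i = 0 := by simpa using hi1
  obtain ⟨f, hf⟩ := exists_hom_ne_zero_of_not_subsingleton_ext_zero _ _ hi
  refine ⟨f.hom (Submodule.Quotient.mk 1), fun h0 ↦ hf ?_, fun a ha ↦ ?_⟩
  · ext : 1
    exact Submodule.linearMap_qext _ (LinearMap.ext_ring h0)
  · rw [← smul_eq_mul, ← map_smul, ← Submodule.Quotient.mk_smul,
      (Submodule.Quotient.mk_eq_zero _).2 (by simpa using ha), map_zero]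

theorem IsMaximalIdealDecomposition.depthM_le_one {I J : Ideal A}
    (h : IsMaximalIdealDecomposition I J) : depthM A A ≤ 1 :=
  sInf_le ⟨1, rfl, fun hs ↦ h.not_subsingleton_ext_one
    ((subsingleton_ext_iff_subsingleton_abelianExt _ _ 0).1 hs)⟩

end Depth

theorem ExtVanishesFrom.extZero {A : Type} [CommRing A] {M N : Type} [AddCommGroup M]
    [Module A M] [AddCommGroup N] [Module A N] {c i : ℕ} (h : ExtVanishesFrom (ModuleCat.of A N) (c + 1) M) (hi : c + 1 ≤ i) :
    ExtZero A M N i := by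
  obtain ⟨i, rfl⟩ : ∃ j, i = j + 1 := ⟨i - 1, by lia⟩
  exact (subsingleton_ext_iff_subsingleton_abelianExt _ _ i).2 (h _ hi)


/-- Corollary 4.4: over the fiber product `R = S ×ₖ T`, if `Ext^i_R(M,N) = 0` for all
`i ≫ 0`, then `Ext^i_R(M,N) = 0` for all `i > depth R`; in particular (since
`depth R ≤ 1`) for all `i ≥ 2`. -/
theorem stmt_16 (S T k : Type) [CommRing S] [CommRing T] [Field k]
    [IsNoetherianRing S] [IsNoetherianRing T] [IsLocalRing S] [IsLocalRing T]
    (πS : S →+* k) (πT : T →+* k)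
    (hπS : Function.Surjective πS) (hπT : Function.Surjective πT)
    (hkS : RingHom.ker πS = maximalIdeal S) (hkT : RingHom.ker πT = maximalIdeal T)
    (hS : maximalIdeal S ≠ ⊥) (hT : maximalIdeal T ≠ ⊥)
    [IsLocalRing ↥(fiberProd πS πT)]
    (M N : Type) [AddCommGroup M] [Module ↥(fiberProd πS πT) M]
    [Module.Finite ↥(fiberProd πS πT) M]
    [AddCommGroup N] [Module ↥(fiberProd πS πT) N]
    [Module.Finite ↥(fiberProd πS πT) N]
    (hvan : ∃ n : ℕ, ∀ i ≥ n, ExtZero ↥(fiberProd πS πT) M N i) :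
    (∀ i : ℕ, depthM ↥(fiberProd πS πT) ↥(fiberProd πS πT) < (i : ℕ∞) →
      ExtZero ↥(fiberProd πS πT) M N i) ∧
    (depthM ↥(fiberProd πS πT) ↥(fiberProd πS πT) ≤ 1 ∧
      ∀ i ≥ 2, ExtZero ↥(fiberProd πS πT) M N i) := by
  have := isNoetherianRing_fiberProd hπS hπT
  have h := isMaximalIdealDecomposition_fiberProd hπS hπT hkS hkT hS hT
  obtain ⟨n, hn⟩ := hvan
  have hM : ExtVanishesFrom (ModuleCat.of (fiberProd πS πT) N) (n + 1) M := fun i hi ↦ by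
    obtain ⟨i, rfl⟩ : ∃ j, i = j + 1 := ⟨i - 1, by lia⟩
    exact (subsingleton_ext_iff_subsingleton_abelianExt _ _ i).1 (hn _ (by lia))
  have : Module.Finite (fiberProd πS πT) (ModuleCat.of (fiberProd πS πT) N) :=
    inferInstanceAs (Module.Finite (fiberProd πS πT) N)
  obtain ⟨h2, h1⟩ := h.extVanishesFrom_two hM
  refine ⟨fun i hi ↦ ?_, h.depthM_le_one, fun i hi ↦ h2.extZero hi⟩
  rcases h.depthM_le_one.lt_or_eq with hd | hd
  · obtain ⟨x, hx, hmx⟩ := exists_socle_of_depthM_lt_one hd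
    refine (h1 x hx hmx).extZero (Nat.one_le_iff_ne_zero.2 ?_)
    rintro rfl
    simp at hi
  · rw [hd] at hi
    exact h2.extZero (by exact_mod_cast hi)
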